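/- Let θ₁, θ₂, θ₃ ∈ (0,π) with θ₁+θ₂+θ₃ = π, and let (v₁,v₂,v₃) ≠ (0,0,0) be real numbers with v₁+v₂+v₃ = 0. Then the function t ↦ Λ(θ₁+tv₁) + Λ(θ₂+tv₂) + Λ(θ₃+tv₃) has strictly negative second derivative at t = 0. -/

import Mathlib

open Real

/-- The Lobachevsky function `Λ(x) = -∫₀ˣ log |2 sin t| dt`. -/
noncomputable def lob (x : ℝ) : ℝ := -∫ t in (0:ℝ)..x, Real.log |2 * Real.sin t|

lemma intervalIntegrable_log_abs_two_mul_sin (a b : ℝ) :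
    IntervalIntegrable (fun t => Real.log |2 * Real.sin t|) MeasureTheory.volume a b := by
  have h : MeromorphicOn (fun t : ℝ => 2 * Real.sin t) (Set.uIcc a b) := by
    intro t _
    exact AnalyticAt.meromorphicAt (by fun_prop)
  exact h.intervalIntegrable_log_norm

lemma hasDerivAt_lob {x : ℝ} (hx : Real.sin x ≠ 0) :
    HasDerivAt lob (-Real.log (2 * Real.sin x)) x := by
  have hc : ContinuousAt (fun t => Real.log |2 * Real.sin t|) x :=
    ContinuousAt.log (by fun_prop) (by simpa using hx)
  have hm : Measurable (fun t => Real.log |2 * Real.sin t|) := by fun_prop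
  have h := intervalIntegral.integral_hasDerivAt_right
    (intervalIntegrable_log_abs_two_mul_sin 0 x)
    hm.stronglyMeasurable.stronglyMeasurableAtFilter hc
  have h' := h.neg
  rw [Real.log_abs] at h'
  exact h'

lemma hasDerivAt_neg_log_two_mul_sin {x : ℝ} (hx : Real.sin x ≠ 0) :
    HasDerivAt (fun y => -Real.log (2 * Real.sin y)) (-(Real.cos x / Real.sin x)) x := by
  have h := (((Real.hasDerivAt_sin x).const_mul 2).log (by simpa using hx)).neg
  rw [mul_div_mul_left _ _ two_ne_zero] at h
  exact h

/-- The derivative of `lob` along an affine line. -/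
lemma hasDerivAt_lob_line (θ v : ℝ) {t : ℝ} (h : Real.sin (θ + t * v) ≠ 0) :
    HasDerivAt (fun s => lob (θ + s * v)) (-Real.log (2 * Real.sin (θ + t * v)) * v) t := by
  have hl : HasDerivAt (fun s : ℝ => θ + s * v) v t := by
    simpa using ((hasDerivAt_id t).mul_const v).const_add θ
  exact HasDerivAt.comp (h₂ := lob) t (hasDerivAt_lob h) hl

/-- The second derivative of `lob` along an affine line. -/
lemma hasDerivAt_neg_log_two_mul_sin_line (θ v : ℝ) (h : Real.sin θ ≠ 0) :
    HasDerivAt (fun s => -Real.log (2 * Real.sin (θ + s * v)) * v)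
      (-(Real.cos θ / Real.sin θ) * v * v) 0 := by
  have hl : HasDerivAt (fun s : ℝ => θ + s * v) v 0 := by
    simpa using ((hasDerivAt_id (0 : ℝ)).mul_const v).const_add θ
  have h' : HasDerivAt (fun y => -Real.log (2 * Real.sin y)) (-(Real.cos θ / Real.sin θ))
      (θ + 0 * v) := by
    simpa using hasDerivAt_neg_log_two_mul_sin h
  exact (h'.comp 0 hl).mul_const v

lemma eventually_sin_line_ne_zero (θ v : ℝ) (h : Real.sin θ ≠ 0) :
    ∀ᶠ t in nhds (0 : ℝ), Real.sin (θ + t * v) ≠ 0 := by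
  have hc : ContinuousAt (fun t : ℝ => Real.sin (θ + t * v)) 0 := by fun_prop
  exact hc.eventually_ne (by simpa using h)

/-- The cotangents of the angles of a triangle define a positive definite quadratic form on the
plane `x + y + z = 0`. -/
lemma cot_quadratic_form_pos {α β γ x y z : ℝ} (hα : 0 < Real.sin α) (hβ : 0 < Real.sin β)
    (hγ : 0 < Real.sin γ) (hsum : α + β + γ = π) (hne : (x, y, z) ≠ (0, 0, 0))
    (hxyz : x + y + z = 0) :
    0 < Real.cos α / Real.sin α * x * x + Real.cos β / Real.sin β * y * y
      + Real.cos γ / Real.sin γ * z * z := by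
  have hβ' : β = π - (α + γ) := by linarith
  have hsin : Real.sin β = Real.sin α * Real.cos γ + Real.cos α * Real.sin γ := by
    rw [hβ', Real.sin_pi_sub, Real.sin_add]
  have hcos : Real.cos β = Real.sin α * Real.sin γ - Real.cos α * Real.cos γ := by
    rw [hβ', Real.cos_pi_sub, Real.cos_add]; ring
  set a := Real.cos α / Real.sin α with ha
  set b := Real.cos β / Real.sin β with hb
  set c := Real.cos γ / Real.sin γ with hc
  have hac : a + c = Real.sin β / (Real.sin α * Real.sin γ) := by
    rw [ha, hc, hsin]; field_simp; ring
  have hac_pos : 0 < a + c := by rw [hac]; positivity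
  have hb_mul : b * (a + c) = 1 - a * c := by
    rw [hac, ha, hb, hc]; field_simp; rw [hcos]
  obtain rfl : z = -(x + y) := by linarith
  have key : (a + c) * (a * x * x + b * y * y + c * -(x + y) * -(x + y))
      = ((a + c) * x + c * y) ^ 2 + y ^ 2 := by
    linear_combination y ^ 2 * hb_mul
  refine pos_of_mul_pos_right (a := a + c) ?_ hac_pos.le
  rw [key]
  by_cases hy : y = 0
  · subst hy
    have hx : x ≠ 0 := by
      rintro rfl
      simp at hne
    have := hac_pos.ne'
    simp only [mul_zero, add_zero]
    positivity
  · positivity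

/-- Along any nonzero direction `(v₁,v₂,v₃)` with `v₁+v₂+v₃ = 0`, the volume of the ideal
tetrahedron with angles `(θ₁+tv₁, θ₂+tv₂, θ₃+tv₃)` has strictly negative second
derivative at `t = 0`. -/
theorem volume_second_derivative_neg (θ₁ θ₂ θ₃ v₁ v₂ v₃ : ℝ)
    (h₁ : θ₁ ∈ Set.Ioo 0 π) (h₂ : θ₂ ∈ Set.Ioo 0 π) (h₃ : θ₃ ∈ Set.Ioo 0 π)
    (hsum : θ₁ + θ₂ + θ₃ = π)
    (hv : (v₁, v₂, v₃) ≠ (0, 0, 0)) (hvsum : v₁ + v₂ + v₃ = 0) :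
    deriv (deriv (fun t : ℝ =>
      lob (θ₁ + t * v₁) + lob (θ₂ + t * v₂) + lob (θ₃ + t * v₃))) 0 < 0 := by
  have s₁ := Real.sin_pos_of_mem_Ioo h₁
  have s₂ := Real.sin_pos_of_mem_Ioo h₂
  have s₃ := Real.sin_pos_of_mem_Ioo h₃
  have hd : deriv (fun t : ℝ => lob (θ₁ + t * v₁) + lob (θ₂ + t * v₂) + lob (θ₃ + t * v₃))
      =ᶠ[nhds 0] fun t => -Real.log (2 * Real.sin (θ₁ + t * v₁)) * v₁
        + -Real.log (2 * Real.sin (θ₂ + t * v₂)) * v₂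
        + -Real.log (2 * Real.sin (θ₃ + t * v₃)) * v₃ := by
    filter_upwards [eventually_sin_line_ne_zero θ₁ v₁ s₁.ne',
      eventually_sin_line_ne_zero θ₂ v₂ s₂.ne',
      eventually_sin_line_ne_zero θ₃ v₃ s₃.ne'] with t n₁ n₂ n₃
    exact (((hasDerivAt_lob_line θ₁ v₁ n₁).add (hasDerivAt_lob_line θ₂ v₂ n₂)).add
      (hasDerivAt_lob_line θ₃ v₃ n₃)).deriv
  have hd₂ := ((hasDerivAt_neg_log_two_mul_sin_line θ₁ v₁ s₁.ne').add
    (hasDerivAt_neg_log_two_mul_sin_line θ₂ v₂ s₂.ne')).add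
    (hasDerivAt_neg_log_two_mul_sin_line θ₃ v₃ s₃.ne')
  rw [hd.deriv_eq]
  refine lt_of_eq_of_lt hd₂.deriv ?_
  linarith [cot_quadratic_form_pos s₁ s₂ s₃ hsum hv hvsum]
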